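/- The maximum shrinkage of the transformed simplex S' with respect to the ℓ∞ norm equals 1/(2q'), i.e., H_{S'}^∞ := sup{Δ ≥ 0 : (S')_Δ^∞ ≠ ∅} = 1/(2 q'). -/

import Mathlib

open Finset

/-- The transformed simplex
`S' = {x : Σ (β m / c m) x m ≤ 1/2, x m ≥ -1/(2 q β m) ∀ m}`. -/
def transformedSimplex (M : ℕ) (c β : Fin M → ℝ) : Set (Fin M → ℝ) :=
  {x | (∑ m, (β m / c m) * x m ≤ 1 / 2) ∧
        ∀ m, x m ≥ -(1 / (2 * (∑ m', 1 / c m') * β m))}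

/-- The shrunk version of a set `Y ⊆ ℝ^M` with respect to the ℓ∞ norm. -/
def shrunkSet (M : ℕ) (Y : Set (Fin M → ℝ)) (Δ : ℝ) : Set (Fin M → ℝ) :=
  {x ∈ Y | ∀ v : Fin M → ℝ, (∀ m, |v m| ≤ Δ) → x + v ∈ Y}

/-- The maximum shrinkage of a set `Y ⊆ ℝ^M` with respect to the ℓ∞ norm:
`H_Y^∞ = sup {Δ ≥ 0 : Y_Δ^∞ ≠ ∅}`. -/
noncomputable def maxShrinkage (M : ℕ) (Y : Set (Fin M → ℝ)) : ℝ :=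
  sSup {Δ : ℝ | 0 ≤ Δ ∧ (shrunkSet M Y Δ).Nonempty}

theorem sum_weighted_lowerBound {M : ℕ} (hM : 0 < M) {c β : Fin M → ℝ}
    (hc : ∀ m, 0 < c m) (hβ : ∀ m, 0 < β m) :
    ∑ m, (β m / c m) * (1 / (2 * (∑ m', 1 / c m') * β m)) = 1 / 2 := by
  have : NeZero M := ⟨hM.ne'⟩
  have hq : 0 < ∑ m', 1 / c m' :=
    Finset.sum_pos (fun m _ => one_div_pos.2 (hc m)) Finset.univ_nonempty
  have hterm : ∀ m, (β m / c m) * (1 / (2 * (∑ m', 1 / c m') * β m)) =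
      1 / c m * (1 / (2 * ∑ m', 1 / c m')) := by
    intro m
    have := (hc m).ne'
    have := (hβ m).ne'
    have := hq.ne'
    generalize ∑ m', 1 / c m' = q at *
    field_simp
  rw [Finset.sum_congr rfl fun m _ => hterm m, ← Finset.sum_mul]
  field_simp

/-- A point lies in the shrunk simplex iff its two extreme translates satisfy the
upper and lower constraints, respectively. -/
theorem mem_shrunkSet_transformedSimplex_iff {M : ℕ} {c β : Fin M → ℝ}
    (hc : ∀ m, 0 < c m) (hβ : ∀ m, 0 < β m) {Δ : ℝ} (hΔ : 0 ≤ Δ) (x : Fin M → ℝ) :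
    x ∈ shrunkSet M (transformedSimplex M c β) Δ ↔
      (∑ m, (β m / c m) * (x m + Δ) ≤ 1 / 2) ∧
        ∀ m, -(1 / (2 * (∑ m', 1 / c m') * β m)) + Δ ≤ x m := by
  constructor
  · rintro ⟨-, h⟩
    refine ⟨(h (fun _ => Δ) fun _ => (abs_of_nonneg hΔ).le).1, fun m => ?_⟩
    have := (h (fun _ => -Δ) fun _ => by rw [abs_neg, abs_of_nonneg hΔ]).2 m
    rw [Pi.add_apply] at this
    linarith
  · rintro ⟨hu, hl⟩
    have key : ∀ v : Fin M → ℝ, (∀ m, |v m| ≤ Δ) → x + v ∈ transformedSimplex M c β := by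
      intro v hv
      refine ⟨(Finset.sum_le_sum fun m _ => ?_).trans hu, fun m => ?_⟩
      · exact mul_le_mul_of_nonneg_left (add_le_add_right (abs_le.1 (hv m)).2 _)
          (div_pos (hβ m) (hc m)).le
      · rw [Pi.add_apply]
        linarith [hl m, (abs_le.1 (hv m)).1]
    exact ⟨by simpa using key 0 (by simpa using fun _ => hΔ), key⟩

/-- The maximum shrinkage of the transformed simplex is `1/(2q')` with
`q' = Σ β m / c m`. -/
theorem maxShrinkage_transformedSimplex (M : ℕ) (hM : 0 < M) (c β : Fin M → ℝ)
    (hc : ∀ m, 0 < c m) (hβ : ∀ m, 0 < β m) :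
    maxShrinkage M (transformedSimplex M c β) = 1 / (2 * ∑ m, β m / c m) := by
  have : NeZero M := ⟨hM.ne'⟩
  have hq' : 0 < ∑ m, β m / c m :=
    Finset.sum_pos (fun m _ => div_pos (hβ m) (hc m)) Finset.univ_nonempty
  have hlow := sum_weighted_lowerBound hM hc hβ
  refine IsGreatest.csSup_eq ⟨⟨by positivity, ?_⟩, ?_⟩
  · refine ⟨fun m => -(1 / (2 * (∑ m', 1 / c m') * β m)) + 1 / (2 * ∑ m, β m / c m),
      (mem_shrunkSet_transformedSimplex_iff hc hβ (by positivity) _).2 ⟨?_, fun m => le_rfl⟩⟩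
    simp only [mul_add, mul_neg, Finset.sum_add_distrib, Finset.sum_neg_distrib,
      ← Finset.sum_mul, hlow]
    field_simp
    norm_num
  · rintro Δ ⟨hΔ, x, hx⟩
    obtain ⟨hu, hl⟩ := (mem_shrunkSet_transformedSimplex_iff hc hβ hΔ x).1 hx
    have h := Finset.sum_le_sum fun m (_ : m ∈ Finset.univ) =>
      mul_le_mul_of_nonneg_left (hl m) (div_pos (hβ m) (hc m)).le
    simp only [mul_add, mul_neg, Finset.sum_add_distrib, Finset.sum_neg_distrib,
      ← Finset.sum_mul, hlow] at h hu
    rw [le_div_iff₀ (by positivity)]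
    linarith
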